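/- Let 0<q<1 with q = e^{πiτ}, and let a ∈ ℂ with Im a not an integer multiple of Im τ. Then e^{2πi(z−Re a)} θ(z−a+τ/2) θ(z−ā+τ/2) is strictly positive for all z ∈ ℝ. -/

import Mathlib

open Complex

/-- The Jacobi theta function `θ(z;τ) = Σ_{n∈ℤ} e^{πiτn²} e^{2πizn}`. -/
noncomputable def jacobiThetaFn (τ z : ℂ) : ℂ :=
  ∑' n : ℤ, Complex.exp (Real.pi * Complex.I * τ * (n : ℂ) ^ 2) *
    Complex.exp (2 * Real.pi * Complex.I * z * (n : ℂ))

open Filter Topology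

/-- The Gaussian binomial coefficient with parameter `p`, defined by the Pascal recursion. -/
def gaussBinom {R : Type*} [CommRing R] (p : R) : ℕ → ℕ → R
  | _, 0 => 1
  | 0, _ + 1 => 0
  | m + 1, j + 1 => gaussBinom p m j + p ^ (j + 1) * gaussBinom p m (j + 1)

section gaussBinom

variable {R : Type*} [CommRing R] (p : R)

@[simp]
lemma gaussBinom_zero_right (m : ℕ) : gaussBinom p m 0 = 1 := by
  cases m <;> rfl

lemma gaussBinom_succ_succ (m j : ℕ) :
    gaussBinom p (m + 1) (j + 1) = gaussBinom p m j + p ^ (j + 1) * gaussBinom p m (j + 1) := rfl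

lemma gaussBinom_eq_zero_of_lt {m j : ℕ} (h : m < j) : gaussBinom p m j = 0 := by
  induction m generalizing j with
  | zero =>
    obtain ⟨j, rfl⟩ := Nat.exists_eq_succ_of_ne_zero h.ne'
    rfl
  | succ m ih =>
    obtain ⟨j, rfl⟩ := Nat.exists_eq_succ_of_ne_zero (Nat.ne_zero_of_lt h)
    rw [Nat.succ_eq_add_one, gaussBinom_succ_succ, ih (by omega), ih (by omega)]
    simp

/-- The finite `q`-Pochhammer symbol `(p; p)_n`. -/
def qPoch (n : ℕ) : R := ∏ i ∈ Finset.range n, (1 - p ^ (i + 1))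

lemma qPoch_succ (n : ℕ) : qPoch p (n + 1) = qPoch p n * (1 - p ^ (n + 1)) :=
  Finset.prod_range_succ _ _

lemma gaussBinom_add_mul_qPoch (a b : ℕ) :
    gaussBinom p (a + b) a * qPoch p a * qPoch p b = qPoch p (a + b) := by
  induction a generalizing b with
  | zero => simp [qPoch]
  | succ a iha =>
    induction b with
    | zero =>
      have h := iha 0
      simp only [add_zero] at h ⊢
      rw [gaussBinom_succ_succ, gaussBinom_eq_zero_of_lt p (Nat.lt_succ_self a), qPoch_succ]
      linear_combination (1 - p ^ (a + 1)) * h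
    | succ b ihb =>
      have h := iha (b + 1)
      rw [show a + 1 + (b + 1) = (a + b + 1) + 1 by ring, gaussBinom_succ_succ,
        qPoch_succ p (a + b + 1)]
      rw [show a + (b + 1) = a + b + 1 by ring, qPoch_succ p b] at h
      rw [show a + 1 + b = a + b + 1 by ring, qPoch_succ p a] at ihb
      rw [qPoch_succ p a, qPoch_succ p b]
      linear_combination (1 - p ^ (a + 1)) * h + p ^ (a + 1) * (1 - p ^ (b + 1)) * ihb

/-- Cauchy's `q`-binomial theorem. -/
lemma prod_one_add_mul_pow_eq_sum_gaussBinom (q y : R) (m : ℕ) :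
    ∏ i ∈ Finset.range m, (1 + y * q ^ (2 * i + 1)) =
      ∑ j ∈ Finset.range (m + 1), gaussBinom (q ^ 2) m j * q ^ (j ^ 2) * y ^ j := by
  induction m generalizing y with
  | zero => simp
  | succ m ih =>
    have hprod : ∏ i ∈ Finset.range m, (1 + y * q ^ (2 * (i + 1) + 1)) =
        ∏ i ∈ Finset.range m, (1 + (y * q ^ 2) * q ^ (2 * i + 1)) :=
      Finset.prod_congr rfl fun i _ ↦ by ring
    have hshift : ∑ j ∈ Finset.range (m + 1),
          gaussBinom (q ^ 2) m (j + 1) * q ^ ((j + 1) ^ 2) * (y * q ^ 2) ^ (j + 1) + 1 =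
        ∑ j ∈ Finset.range (m + 1), gaussBinom (q ^ 2) m j * q ^ (j ^ 2) * (y * q ^ 2) ^ j := by
      have h := Finset.sum_range_succ'
        (fun j ↦ gaussBinom (q ^ 2) m j * q ^ (j ^ 2) * (y * q ^ 2) ^ j) (m + 1)
      rw [Finset.sum_range_succ, gaussBinom_eq_zero_of_lt _ (Nat.lt_succ_self m)] at h
      simpa using h.symm
    rw [Finset.prod_range_succ', hprod, ih, Finset.sum_range_succ' _ (m + 1), mul_add, mul_one]
    nth_rw 1 [← hshift]
    rw [Finset.sum_mul, add_right_comm, ← Finset.sum_add_distrib]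
    simp only [gaussBinom_zero_right]
    congr 1
    · refine Finset.sum_congr rfl fun j _ ↦ ?_
      rw [gaussBinom_succ_succ]
      ring
    · simp

end gaussBinom

/-- The finite form of the Jacobi triple product identity. -/
lemma prod_mul_prod_eq_sum_gaussBinom {K : Type*} [Field K] {q x : K} (hq : q ≠ 0) (hx : x ≠ 0)
    (n : ℕ) :
    (∏ i ∈ Finset.range n, (1 + x * q ^ (2 * i + 1))) *
        ∏ i ∈ Finset.range n, (1 + x⁻¹ * q ^ (2 * i + 1)) =
      ∑ j ∈ Finset.range (2 * n + 1),
        gaussBinom (q ^ 2) (2 * n) j * q ^ (((j : ℤ) - n) ^ 2) * x ^ ((j : ℤ) - n) := by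
  have hy := prod_one_add_mul_pow_eq_sum_gaussBinom q (x * q ^ (-(2 * n : ℤ))) (2 * n)
  have hlow : ∀ n : ℕ, ∏ i ∈ Finset.range n, (1 + x * q ^ (-(2 * n : ℤ)) * q ^ (2 * i + 1)) =
      x ^ (n : ℤ) * q ^ (-(n : ℤ) ^ 2) *
        ∏ i ∈ Finset.range n, (1 + x⁻¹ * q ^ (2 * i + 1)) := by
    intro n
    induction n with
    | zero => simp
    | succ n ih =>
      have hprod : ∏ i ∈ Finset.range n,
            (1 + x * q ^ (-(2 * (n + 1 : ℕ) : ℤ)) * q ^ (2 * (i + 1) + 1)) =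
          ∏ i ∈ Finset.range n, (1 + x * q ^ (-(2 * n : ℤ)) * q ^ (2 * i + 1)) := by
        refine Finset.prod_congr rfl fun i _ ↦ ?_
        have : q ^ (-(2 * (n + 1 : ℕ) : ℤ)) * q ^ 2 = q ^ (-(2 * n : ℤ)) := by
          rw [← zpow_natCast q 2, ← zpow_add₀ hq]
          congr 1
          push_cast
          ring
        rw [← this]
        ring
      rw [Finset.prod_range_succ', hprod, ih, Finset.prod_range_succ]
      have h1 : q ^ (-((n + 1 : ℕ) : ℤ) ^ 2) = q ^ (-(n : ℤ) ^ 2) * (q ^ (2 * n + 1))⁻¹ := by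
        rw [← zpow_natCast, ← zpow_neg, ← zpow_add₀ hq]
        congr 1
        push_cast
        ring
      have h2 : q ^ (-(2 * (n + 1 : ℕ) : ℤ)) * q ^ (2 * 0 + 1) = (q ^ (2 * n + 1))⁻¹ := by
        rw [← zpow_natCast, ← zpow_natCast, ← zpow_neg, ← zpow_add₀ hq]
        congr 1
      rw [mul_assoc x, h1, h2, Nat.cast_succ, zpow_add_one₀ hx]
      field_simp
      ring
  have hhigh : ∏ i ∈ Finset.range n,
        (1 + x * q ^ (-(2 * n : ℤ)) * q ^ (2 * (n + i) + 1)) =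
      ∏ i ∈ Finset.range n, (1 + x * q ^ (2 * i + 1)) := by
    refine Finset.prod_congr rfl fun i _ ↦ ?_
    have : q ^ (-(2 * n : ℤ)) * q ^ (2 * (n + i) + 1) = q ^ (2 * i + 1) := by
      rw [← zpow_natCast, ← zpow_natCast, ← zpow_add₀ hq]
      congr 1
      push_cast
      ring
    rw [mul_assoc, this]
  rw [two_mul n, Finset.prod_range_add, ← two_mul n, hlow, hhigh] at hy
  have hc : x ^ (n : ℤ) * q ^ (-(n : ℤ) ^ 2) ≠ 0 :=
    mul_ne_zero (zpow_ne_zero _ hx) (zpow_ne_zero _ hq)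
  apply mul_left_cancel₀ hc
  rw [Finset.mul_sum]
  calc _ = _ := by ring
    _ = _ := hy
    _ = _ := Finset.sum_congr rfl fun j _ ↦ ?_
  have h1 : x ^ (j : ℤ) = x ^ (n : ℤ) * x ^ ((j : ℤ) - n) := by
    rw [← zpow_add₀ hx]
    congr 1
    ring
  have h2 : q ^ (j ^ 2) * (q ^ (-(2 * n : ℤ))) ^ j =
      q ^ (-(n : ℤ) ^ 2) * q ^ (((j : ℤ) - n) ^ 2) := by
    rw [← zpow_natCast, ← zpow_natCast, ← zpow_mul, ← zpow_add₀ hq, ← zpow_add₀ hq]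
    congr 1
    push_cast
    ring
  rw [mul_pow, ← zpow_natCast x j, h1]
  linear_combination gaussBinom (q ^ 2) (2 * n) j * x ^ (n : ℤ) * x ^ ((j : ℤ) - n) * h2

section limits

variable {p : ℂ} (hp : ‖p‖ < 1)

include hp

lemma one_sub_pow_succ_ne_zero_of_norm_lt_one (i : ℕ) : 1 - p ^ (i + 1) ≠ 0 := by
  intro h
  have h1 : ‖p ^ (i + 1)‖ < 1 := by
    rw [norm_pow]
    exact pow_lt_one₀ (norm_nonneg _) hp (Nat.succ_ne_zero i)
  rw [← sub_eq_zero.mp h] at h1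
  simp at h1

lemma qPoch_ne_zero (n : ℕ) : qPoch p n ≠ 0 :=
  Finset.prod_ne_zero_iff.mpr fun i _ ↦ one_sub_pow_succ_ne_zero_of_norm_lt_one hp i

lemma exists_tendsto_qPoch : ∃ c : ℂ, c ≠ 0 ∧ Tendsto (qPoch p) atTop (𝓝 c) := by
  have hs : Summable fun i : ℕ ↦ ‖-p ^ (i + 1)‖ := by
    simpa using (summable_nat_add_iff 1).mpr (summable_geometric_of_lt_one (norm_nonneg _) hp)
  refine ⟨∏' i : ℕ, (1 + -p ^ (i + 1)), tprod_one_add_ne_zero_of_summable (fun i ↦ ?_) hs, ?_⟩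
  · simpa [← sub_eq_add_neg] using one_sub_pow_succ_ne_zero_of_norm_lt_one hp i
  · refine (multipliable_one_add_of_summable hs).hasProd.tendsto_prod_nat.congr fun n ↦ ?_
    simp only [qPoch, sub_eq_add_neg]

lemma gaussBinom_eq_div {m j : ℕ} (h : j ≤ m) :
    gaussBinom p m j = qPoch p m * (qPoch p j)⁻¹ * (qPoch p (m - j))⁻¹ := by
  have h1 := qPoch_ne_zero hp j
  have h2 := qPoch_ne_zero hp (m - j)
  have := gaussBinom_add_mul_qPoch p j (m - j)
  rw [Nat.add_sub_cancel' h] at this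
  rw [← this]
  field_simp

lemma exists_norm_gaussBinom_le : ∃ C : ℝ, ∀ m j, ‖gaussBinom p m j‖ ≤ C := by
  obtain ⟨c, hc, hlim⟩ := exists_tendsto_qPoch hp
  obtain ⟨A, hA⟩ := (Metric.isBounded_range_of_tendsto _ hlim).exists_norm_le
  obtain ⟨B, hB⟩ := (Metric.isBounded_range_of_tendsto _ (hlim.inv₀ hc)).exists_norm_le
  have hA' n : ‖qPoch p n‖ ≤ A := hA _ ⟨n, rfl⟩
  have hB' n : ‖(qPoch p n)⁻¹‖ ≤ B := hB _ ⟨n, rfl⟩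
  have hA0 : 0 ≤ A := (norm_nonneg _).trans (hA' 0)
  have hB0 : 0 ≤ B := (norm_nonneg _).trans (hB' 0)
  refine ⟨A * B * B, fun m j ↦ ?_⟩
  rcases le_or_gt j m with h | h
  · rw [gaussBinom_eq_div hp h, norm_mul, norm_mul]
    gcongr
    exacts [hA' m, hB' j, hB' (m - j)]
  · rw [gaussBinom_eq_zero_of_lt p h, norm_zero]
    positivity

lemma tendsto_gaussBinom_central {c : ℂ} (hc : c ≠ 0) (hlim : Tendsto (qPoch p) atTop (𝓝 c))
    (k : ℤ) : Tendsto (fun n : ℕ ↦ gaussBinom p (2 * n) (k + n).toNat) atTop (𝓝 c⁻¹) := by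
  have h1 : Tendsto (fun n : ℕ ↦ 2 * n) atTop atTop :=
    tendsto_atTop_mono (fun n ↦ Nat.le_mul_of_pos_left n two_pos) tendsto_id
  have h2 : Tendsto (fun n : ℕ ↦ (k + n).toNat) atTop atTop :=
    tendsto_atTop.mpr fun b ↦ (eventually_ge_atTop (b + k.natAbs)).mono fun n hn ↦ by omega
  have h3 : Tendsto (fun n : ℕ ↦ 2 * n - (k + n).toNat) atTop atTop :=
    tendsto_atTop.mpr fun b ↦ (eventually_ge_atTop (b + k.natAbs)).mono fun n hn ↦ by omega
  have := ((hlim.comp h1).mul ((hlim.comp h2).inv₀ hc)).mul ((hlim.comp h3).inv₀ hc)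
  rw [mul_inv_cancel₀ hc, one_mul] at this
  refine this.congr' ?_
  filter_upwards [eventually_ge_atTop k.natAbs] with n hn
  exact (gaussBinom_eq_div hp (m := 2 * n) (j := (k + n).toNat) (by omega)).symm

end limits

/-- The Jacobi triple product identity, with the normalising constant left implicit. -/
lemma exists_tendsto_prod_jacobi {q x : ℂ} (hq : q ≠ 0) (hq1 : ‖q‖ < 1) (hx : x ≠ 0)
    (hs : Summable fun k : ℤ ↦ q ^ (k ^ 2) * x ^ k) :
    ∃ c : ℂ, Tendsto (fun n ↦ (∏ i ∈ Finset.range n, (1 + x * q ^ (2 * i + 1))) *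
        ∏ i ∈ Finset.range n, (1 + x⁻¹ * q ^ (2 * i + 1))) atTop
      (𝓝 (c * ∑' k : ℤ, q ^ (k ^ 2) * x ^ k)) := by
  have hp : ‖q ^ 2‖ < 1 := by
    rw [norm_pow]
    exact pow_lt_one₀ (norm_nonneg _) hq1 two_ne_zero
  obtain ⟨c, hc, hlim⟩ := exists_tendsto_qPoch hp
  obtain ⟨C, hC⟩ := exists_norm_gaussBinom_le hp
  refine ⟨c⁻¹, ?_⟩
  let f (n : ℕ) (k : ℤ) : ℂ :=
    if -(n : ℤ) ≤ k then gaussBinom (q ^ 2) (2 * n) (k + n).toNat * (q ^ (k ^ 2) * x ^ k) else 0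
  have hf (n : ℕ) : ∑' k, f n k = (∏ i ∈ Finset.range n, (1 + x * q ^ (2 * i + 1))) *
        ∏ i ∈ Finset.range n, (1 + x⁻¹ * q ^ (2 * i + 1)) := by
    have hinj : Function.Injective fun j : ℕ ↦ (j : ℤ) - n := fun a b h ↦ by
      simpa using h
    rw [prod_mul_prod_eq_sum_gaussBinom hq hx,
      tsum_eq_sum (s := (Finset.range (2 * n + 1)).image fun j : ℕ ↦ (j : ℤ) - n),
      Finset.sum_image hinj.injOn]
    · refine Finset.sum_congr rfl fun j _ ↦ ?_
      simp [f, mul_assoc]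
    · intro k hk
      by_cases hkn : -(n : ℤ) ≤ k
      · have : 2 * n < (k + n).toNat := by
          by_contra! h
          exact hk (Finset.mem_image.mpr ⟨(k + n).toNat, by simp; omega, by omega⟩)
        simp [f, gaussBinom_eq_zero_of_lt _ this]
      · simp [f, hkn]
  rw [← tsum_mul_left]
  refine (tendsto_tsum_of_dominated_convergence (f := f)
    (bound := fun k ↦ C * ‖q ^ (k ^ 2) * x ^ k‖) (hs.norm.mul_left C) (fun k ↦ ?_)
    (Eventually.of_forall fun n k ↦ ?_)).congr hf
  · refine ((tendsto_gaussBinom_central hp hc hlim k).mul_const _).congr' ?_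
    filter_upwards [eventually_ge_atTop k.natAbs] with n hn
    simp only [f]
    rw [if_pos (by omega)]
  · have hC0 : 0 ≤ C := (norm_nonneg _).trans (hC 0 0)
    by_cases hkn : -(n : ℤ) ≤ k
    · simp only [f, if_pos hkn, norm_mul (gaussBinom _ _ _)]
      gcongr
      exact hC _ _
    · simp only [f, if_neg hkn, norm_zero]
      positivity

lemma exists_tendsto_prod_one_add_mul_odd_pow {q x : ℂ} (hq1 : ‖q‖ < 1)
    (hx : ∀ i : ℕ, 1 + x * q ^ (2 * i + 1) ≠ 0) :
    ∃ P : ℂ, P ≠ 0 ∧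
      Tendsto (fun n ↦ ∏ i ∈ Finset.range n, (1 + x * q ^ (2 * i + 1))) atTop (𝓝 P) := by
  have hs : Summable fun i : ℕ ↦ ‖x * q ^ (2 * i + 1)‖ := by
    have h2 : ‖q‖ ^ 2 < 1 := pow_lt_one₀ (norm_nonneg _) hq1 two_ne_zero
    refine ((summable_geometric_of_lt_one (by positivity) h2).mul_left (‖x‖ * ‖q‖)).congr
      fun i ↦ ?_
    rw [norm_mul, norm_pow]
    ring
  exact ⟨_, tprod_one_add_ne_zero_of_summable hx hs,
    (multipliable_one_add_of_summable hs).hasProd.tendsto_prod_nat⟩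

/-- The Jacobi theta function does not vanish at points whose imaginary part is not congruent to
`Im τ / 2` modulo `Im τ`. -/
lemma jacobiTheta₂_ne_zero {z τ : ℂ} (hτ : 0 < τ.im)
    (hz : ∀ k : ℤ, z.im ≠ (k + 1 / 2 : ℝ) * τ.im) : jacobiTheta₂ z τ ≠ 0 := by
  set q : ℂ := exp (Real.pi * I * τ) with hqdef
  set x : ℂ := exp (2 * Real.pi * I * z) with hxdef
  have hpi := Real.pi_pos
  have hq1 : ‖q‖ < 1 := by
    rw [hqdef, norm_exp, Real.exp_lt_one_iff]
    simp
    positivity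
  have hterm (k : ℤ) : jacobiTheta₂_term k z τ = q ^ (k ^ 2) * x ^ k := by
    rw [jacobiTheta₂_term, hqdef, hxdef, ← exp_int_mul, ← exp_int_mul, ← exp_add]
    congr 1
    push_cast
    ring
  have hs : Summable fun k : ℤ ↦ q ^ (k ^ 2) * x ^ k := by
    simpa only [hterm] using (summable_jacobiTheta₂_term_iff z τ).mpr hτ
  have hne {w : ℂ} (hw : ∀ k : ℤ, w.im ≠ (k + 1 / 2 : ℝ) * τ.im) (i : ℕ) :
      1 + exp (2 * Real.pi * I * w) * q ^ (2 * i + 1) ≠ 0 := by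
    intro h
    have h1 : ‖exp (2 * Real.pi * I * w) * q ^ (2 * i + 1)‖ = 1 := by
      rw [eq_neg_of_add_eq_zero_right h]
      simp
    rw [hqdef, ← exp_nat_mul, ← exp_add, norm_exp, Real.exp_eq_one_iff] at h1
    simp at h1
    refine hw (-i - 1) ?_
    push_cast
    apply mul_left_cancel₀ hpi.ne'
    linarith
  obtain ⟨P, hP, hPlim⟩ := exists_tendsto_prod_one_add_mul_odd_pow hq1 (hne hz)
  have hz' (k : ℤ) : (-z).im ≠ (k + 1 / 2 : ℝ) * τ.im := by
    intro h
    refine hz (-k - 1) ?_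
    rw [neg_im] at h
    push_cast
    linarith
  obtain ⟨Q, hQ, hQlim⟩ := exists_tendsto_prod_one_add_mul_odd_pow hq1 (hne hz')
  rw [mul_neg, exp_neg] at hQlim
  obtain ⟨c, hc⟩ := exists_tendsto_prod_jacobi (exp_ne_zero _) hq1 (exp_ne_zero _) hs
  have hPQ := tendsto_nhds_unique (hPlim.mul hQlim) hc
  intro h0
  rw [jacobiTheta₂, tsum_congr hterm] at h0
  rw [h0, mul_zero] at hPQ
  exact mul_ne_zero hP hQ hPQ

lemma jacobiThetaFn_eq_jacobiTheta₂ (τ z : ℂ) : jacobiThetaFn τ z = jacobiTheta₂ z τ := by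
  refine tsum_congr fun n ↦ ?_
  rw [jacobiTheta₂_term, ← exp_add]
  congr 1
  ring

theorem theta_pair_shifted_pos_on_real (q : ℝ) (hq0 : 0 < q) (hq1 : q < 1) (τ : ℂ)
    (hτre : τ.re = 0) (hτim : 0 < τ.im)
    (hqτ : (q : ℂ) = Complex.exp (Real.pi * Complex.I * τ)) (a : ℂ)
    (ha : ∀ k : ℤ, a.im ≠ (k : ℝ) * τ.im) :
    ∀ z : ℝ, ∃ r : ℝ, 0 < r ∧
      Complex.exp (2 * Real.pi * Complex.I * ((z : ℂ) - (a.re : ℂ))) *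
        jacobiThetaFn τ ((z : ℂ) - a + τ / 2) *
        jacobiThetaFn τ ((z : ℂ) - (starRingEnd ℂ) a + τ / 2) = (r : ℂ) := by
  intro z
  simp only [jacobiThetaFn_eq_jacobiTheta₂]
  set v : ℂ := (z : ℂ) - a + τ / 2 with hv
  have hconjτ : (starRingEnd ℂ) τ = -τ := by
    apply Complex.ext <;> simp [hτre]
  have hconjv : (z : ℂ) - (starRingEnd ℂ) a + τ / 2 = (starRingEnd ℂ) v + τ := by
    simp only [hv, map_add, map_sub, conj_ofReal, map_div₀, hconjτ, map_ofNat]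
    ring
  have hconjθ : jacobiTheta₂ ((starRingEnd ℂ) v) τ = (starRingEnd ℂ) (jacobiTheta₂ v τ) := by
    rw [jacobiTheta₂_conj, hconjτ, neg_neg]
  have hne : jacobiTheta₂ v τ ≠ 0 := by
    refine jacobiTheta₂_ne_zero hτim fun k hk ↦ ha (-k) ?_
    have him : v.im = -a.im + τ.im / 2 := by simp [hv]
    rw [him] at hk
    push_cast
    linarith
  refine ⟨Real.exp (2 * Real.pi * a.im) * normSq (jacobiTheta₂ v τ),
    mul_pos (Real.exp_pos _) (normSq_pos.mpr hne), ?_⟩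
  have hexp : exp (2 * Real.pi * I * ((z : ℂ) - (a.re : ℂ))) *
      exp (-Real.pi * I * (τ + 2 * (starRingEnd ℂ) v)) = exp (2 * Real.pi * a.im) := by
    rw [← exp_add]
    congr 1
    have hv' : (starRingEnd ℂ) v = z - (a.re - a.im * I) - τ / 2 := by
      have hconja : (starRingEnd ℂ) a = a.re - a.im * I := by
        apply Complex.ext <;> simp
      rw [← hconja]
      linear_combination -hconjv
    rw [hv']
    linear_combination (-2 * Real.pi * a.im : ℂ) * I_sq
  rw [hconjv, jacobiTheta₂_add_left', hconjθ]
  push_cast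
  rw [← hexp, ← mul_conj]
  ring
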